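/- arXiv:2501.00471 — 2 statements merged into one kernel-verified Lean document; each statement's English description precedes it below -/
import Mathlib

section
/- Let a ∈ ℝⁿ satisfy a₁ ≥ a₂ ≥ ⋯ ≥ aₙ ≥ 0 and a ≠ 0, and let τ > 0 with τ ≠ 1/√‖a‖₀. Then the problem (P_{a,τ}) has a unique optimal solution. -/
/-- The objective function of problem (P_{a,τ}):
`h(s) = ‖s − a‖₂ + τ‖s‖₁`. -/
noncomputable def srObj {n : ℕ} (a : Fin n → ℝ) (τ : ℝ) (s : Fin n → ℝ) : ℝ :=
  Real.sqrt (∑ i, (s i - a i) ^ 2) + τ * ∑ i, |s i|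

/-- `‖v‖₀`: the number of nonzero entries of `v`. -/
noncomputable def norm0 {n : ℕ} (v : Fin n → ℝ) : ℕ :=
  (Finset.univ.filter fun i => v i ≠ 0).card

theorem norm_toLp_sub_eq_sqrt {n : ℕ} (a s : Fin n → ℝ) :
    ‖WithLp.toLp 2 (s - a)‖ = Real.sqrt (∑ i, (s i - a i) ^ 2) := by
  simp [EuclideanSpace.norm_eq]

theorem continuous_srObj {n : ℕ} (a : Fin n → ℝ) (τ : ℝ) : Continuous (srObj a τ) := by
  unfold srObj
  fun_prop

theorem sqrt_sum_sq_clamp_le {n : ℕ} {a : Fin n → ℝ} (ha : ∀ i, 0 ≤ a i) (s : Fin n → ℝ) :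
    Real.sqrt (∑ i, (max 0 (min (s i) (a i)) - a i) ^ 2) ≤
      Real.sqrt (∑ i, (s i - a i) ^ 2) := by
  refine Real.sqrt_le_sqrt (Finset.sum_le_sum fun i _ => sq_le_sq.2 ?_)
  have := ha i
  grind

theorem abs_clamp_le {x b : ℝ} (hb : 0 ≤ b) : |max 0 (min x b)| ≤ |x| := by
  grind

theorem srObj_clamp_le {n : ℕ} {a : Fin n → ℝ} (ha : ∀ i, 0 ≤ a i) {τ : ℝ} (hτ : 0 ≤ τ)
    (s : Fin n → ℝ) : srObj a τ (fun i => max 0 (min (s i) (a i))) ≤ srObj a τ s :=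
  add_le_add (sqrt_sum_sq_clamp_le ha s)
    (mul_le_mul_of_nonneg_left (Finset.sum_le_sum fun i _ => abs_clamp_le (ha i)) hτ)

theorem exists_srObj_minimizer {n : ℕ} {a : Fin n → ℝ} (ha : ∀ i, 0 ≤ a i) {τ : ℝ}
    (hτ : 0 ≤ τ) : ∃ t, ∀ s, srObj a τ t ≤ srObj a τ s := by
  obtain ⟨t, -, ht⟩ := (isCompact_Icc (a := (0 : Fin n → ℝ)) (b := a)).exists_isMinOn
    ⟨0, le_rfl, ha⟩ (continuous_srObj a τ).continuousOn
  refine ⟨t, fun s => le_trans (ht ⟨fun i => ?_, fun i => ?_⟩) (srObj_clamp_le ha hτ s)⟩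
  · exact le_max_left _ _
  · exact max_le (ha i) (min_le_right _ _)

theorem srObj_minimizer_mem_Icc {n : ℕ} {a : Fin n → ℝ} (ha : ∀ i, 0 ≤ a i) {τ : ℝ}
    (hτ : 0 < τ) {t : Fin n → ℝ} (ht : ∀ s, srObj a τ t ≤ srObj a τ s) (i : Fin n) :
    0 ≤ t i ∧ t i ≤ a i := by
  have h := ht (fun i => max 0 (min (t i) (a i)))
  have h₂ := sqrt_sum_sq_clamp_le ha t
  unfold srObj at h
  have hle : ∑ i, |t i| ≤ ∑ i, |max 0 (min (t i) (a i))| :=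
    le_of_mul_le_mul_left (by linarith) hτ
  have heq := (Finset.sum_eq_sum_iff_of_le fun i _ => abs_clamp_le (x := t i) (ha i)).1
    (le_antisymm (Finset.sum_le_sum fun i _ => abs_clamp_le (ha i)) hle) i (Finset.mem_univ i)
  have := ha i
  grind

theorem srObj_eq_of_nonneg {n : ℕ} (a : Fin n → ℝ) (τ : ℝ) {s : Fin n → ℝ}
    (hs : ∀ i, 0 ≤ s i) :
    srObj a τ s = ‖WithLp.toLp 2 (s - a)‖ + τ * ∑ i, s i := by
  simp only [srObj, norm_toLp_sub_eq_sqrt, abs_of_nonneg (hs _)]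

theorem neg_sum_le_sqrt_norm0_mul_norm {n : ℕ} {a u : Fin n → ℝ}
    (hu : ∀ i, a i = 0 → u i = 0) :
    -∑ i, u i ≤ Real.sqrt (norm0 a) * ‖WithLp.toLp 2 u‖ := by
  have hsum : ∑ i, u i = ∑ i with a i ≠ 0, u i :=
    (Finset.sum_filter_of_ne fun i _ h => mt (hu i) h).symm
  rw [EuclideanSpace.norm_eq, ← Real.sqrt_mul (Nat.cast_nonneg _)]
  apply Real.le_sqrt_of_sq_le
  rw [neg_sq, hsum]
  refine (sq_sum_le_card_mul_sum_sq).trans (mul_le_mul_of_nonneg_left ?_ (Nat.cast_nonneg _))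
  simpa using Finset.sum_le_sum_of_subset_of_nonneg (Finset.filter_subset (fun i => a i ≠ 0) _)
    fun i _ _ => sq_nonneg (u i)

theorem norm0_pos {n : ℕ} {a : Fin n → ℝ} (ha : a ≠ 0) : 0 < norm0 a := by
  obtain ⟨i, hi⟩ := Function.ne_iff.1 ha
  exact Finset.card_pos.2 ⟨i, by simpa using hi⟩

theorem exists_pos_le_of_ne_zero {n : ℕ} {a : Fin n → ℝ} (ha : ∀ i, 0 ≤ a i) (hne : a ≠ 0) :
    ∃ ε > 0, ∀ i, a i ≠ 0 → ε ≤ a i := by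
  obtain ⟨j, hj, hmin⟩ := Finset.exists_min_image _ a (Finset.card_pos.1 (norm0_pos hne))
  refine ⟨a j, lt_of_le_of_ne (ha j) (Ne.symm (by simpa using hj)), fun i hi => hmin i ?_⟩
  simpa using hi

theorem mul_sqrt_norm0_le_one {n : ℕ} {a : Fin n → ℝ} (ha : ∀ i, 0 ≤ a i) (hne : a ≠ 0)
    {τ : ℝ} (hmin : ∀ s, srObj a τ a ≤ srObj a τ s) : τ * Real.sqrt (norm0 a) ≤ 1 := by
  obtain ⟨ε, hε, hle⟩ := exists_pos_le_of_ne_zero ha hne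
  have hs (i : Fin n) : 0 ≤ a i - if a i ≠ 0 then ε else 0 := by
    split_ifs with h
    · linarith [hle i h]
    · linarith [ha i]
  have h := hmin fun i => a i - if a i ≠ 0 then ε else 0
  have hsq : ∑ i, ((a i - if a i ≠ 0 then ε else 0) - a i) ^ 2 = norm0 a * ε ^ 2 := by
    simp only [sub_sub_cancel_left, neg_sq, ite_pow, norm0, zero_pow two_ne_zero]
    rw [← Finset.sum_filter, Finset.sum_const, nsmul_eq_mul]
  have hsum : ∑ i, (if a i ≠ 0 then ε else 0) = norm0 a * ε := by
    rw [← Finset.sum_filter, Finset.sum_const, nsmul_eq_mul, norm0]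
  unfold srObj at h
  simp only [abs_of_nonneg (ha _), abs_of_nonneg (hs _)] at h
  rw [hsq, Finset.sum_sub_distrib, hsum, Real.sqrt_mul (Nat.cast_nonneg _),
    Real.sqrt_sq hε.le] at h
  simp only [sub_self, zero_pow two_ne_zero, Finset.sum_const_zero, Real.sqrt_zero] at h
  have hk : 0 < Real.sqrt (norm0 a) := Real.sqrt_pos.2 (Nat.cast_pos.2 (norm0_pos hne))
  have hkk : Real.sqrt (norm0 a) * Real.sqrt (norm0 a) = norm0 a :=
    Real.mul_self_sqrt (Nat.cast_nonneg _)
  refine le_of_mul_le_mul_right ?_ (mul_pos hk hε)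
  calc τ * Real.sqrt (norm0 a) * (Real.sqrt (norm0 a) * ε)
      = τ * ((Real.sqrt (norm0 a) * Real.sqrt (norm0 a)) * ε) := by ring
    _ = τ * (norm0 a * ε) := by rw [hkk]
    _ ≤ 1 * (Real.sqrt (norm0 a) * ε) := by linarith

theorem sameRay_of_srObj_minimizers {n : ℕ} {a : Fin n → ℝ} {τ : ℝ} {s t : Fin n → ℝ}
    (hs0 : ∀ i, 0 ≤ s i) (ht0 : ∀ i, 0 ≤ t i)
    (hs : ∀ r, srObj a τ s ≤ srObj a τ r) (ht : ∀ r, srObj a τ t ≤ srObj a τ r) :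
    SameRay ℝ (WithLp.toLp 2 (s - a)) (WithLp.toLp 2 (t - a)) := by
  have hm0 (i : Fin n) : 0 ≤ ((1 / 2 : ℝ) • (s + t)) i := by
    have := hs0 i
    have := ht0 i
    simp only [Pi.smul_apply, Pi.add_apply, smul_eq_mul]
    linarith
  have h₁ := hs ((1 / 2 : ℝ) • (s + t))
  have h₂ := ht ((1 / 2 : ℝ) • (s + t))
  rw [srObj_eq_of_nonneg a τ hm0] at h₁ h₂
  rw [srObj_eq_of_nonneg a τ hs0] at h₁
  rw [srObj_eq_of_nonneg a τ ht0] at h₂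
  have hmid : WithLp.toLp 2 ((1 / 2 : ℝ) • (s + t) - a) =
      (1 / 2 : ℝ) • (WithLp.toLp 2 (s - a) + WithLp.toLp 2 (t - a)) := by
    ext i
    simp
    ring
  have hsum : ∑ i, ((1 / 2 : ℝ) • (s + t)) i = (1 / 2) * (∑ i, s i + ∑ i, t i) := by
    simp only [Pi.smul_apply, Pi.add_apply, smul_eq_mul]
    rw [← Finset.mul_sum, Finset.sum_add_distrib]
  rw [hmid, norm_smul, hsum, Real.norm_of_nonneg (by norm_num)] at h₁ h₂
  refine sameRay_iff_norm_add.2 (le_antisymm (norm_add_le _ _) ?_)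
  linarith

theorem eq_one_div_sqrt_norm0_of_srObj_minimizers_ne {n : ℕ} {a : Fin n → ℝ}
    (ha : ∀ i, 0 ≤ a i) (hne : a ≠ 0) {τ : ℝ} (hτ : 0 < τ) {s t : Fin n → ℝ}
    (hs : ∀ r, srObj a τ s ≤ srObj a τ r) (ht : ∀ r, srObj a τ t ≤ srObj a τ r)
    (hst : s ≠ t) : τ = 1 / Real.sqrt (norm0 a) := by
  have hsI := srObj_minimizer_mem_Icc ha hτ hs
  have htI := srObj_minimizer_mem_Icc ha hτ ht
  obtain ⟨α, β, hα, hβ, hαβ, hsu, htu⟩ :=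
    (sameRay_of_srObj_minimizers (fun i => (hsI i).1) (fun i => (htI i).1) hs ht).exists_eq_smul_add
  set u : Fin n → ℝ := (s - a) + (t - a) with hu
  rw [← WithLp.toLp_add, ← hu] at hsu htu
  have hsi (i : Fin n) : s i = a i + α * u i := by
    have := congrArg (fun v => v i) hsu
    simp only [PiLp.smul_apply, Pi.sub_apply, smul_eq_mul] at this
    linarith
  have hti (i : Fin n) : t i = a i + β * u i := by
    have := congrArg (fun v => v i) htu
    simp only [PiLp.smul_apply, Pi.sub_apply, smul_eq_mul] at this
    linarith
  have hαβ' : α - β ≠ 0 := fun h => hst <| funext fun i => by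
    rw [hsi, hti, sub_eq_zero.1 h]
  have hsval : srObj a τ s =
      τ * ∑ i, a i + α * (‖WithLp.toLp 2 u‖ + τ * ∑ i, u i) := by
    rw [srObj_eq_of_nonneg a τ fun i => (hsI i).1, hsu, norm_smul, Real.norm_of_nonneg hα]
    simp only [hsi, Finset.sum_add_distrib, ← Finset.mul_sum]
    ring
  have htval : srObj a τ t =
      τ * ∑ i, a i + β * (‖WithLp.toLp 2 u‖ + τ * ∑ i, u i) := by
    rw [srObj_eq_of_nonneg a τ fun i => (htI i).1, htu, norm_smul, Real.norm_of_nonneg hβ]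
    simp only [hti, Finset.sum_add_distrib, ← Finset.mul_sum]
    ring
  have hzero : ‖WithLp.toLp 2 u‖ + τ * ∑ i, u i = 0 := by
    refine (mul_eq_zero.1 ?_).resolve_left hαβ'
    linarith [hs t, ht s]
  have haval : srObj a τ a = srObj a τ s := by
    rw [hsval, hzero, srObj_eq_of_nonneg a τ ha]
    simp
  have hu0 : 0 < ‖WithLp.toLp 2 u‖ := norm_pos_iff.2 fun h => hst <| funext fun i => by
    have : u i = 0 := congrArg (fun v => v i) h
    rw [hsi, hti, this, mul_zero, mul_zero]
  have hCS : -∑ i, u i ≤ Real.sqrt (norm0 a) * ‖WithLp.toLp 2 u‖ :=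
    neg_sum_le_sqrt_norm0_mul_norm fun i hi => by
      have := hsI i
      have := htI i
      simp only [hu, Pi.add_apply, Pi.sub_apply]
      linarith
  have hge : 1 ≤ τ * Real.sqrt (norm0 a) := by
    refine le_of_mul_le_mul_right ?_ hu0
    have := mul_le_mul_of_nonneg_left hCS hτ.le
    linarith
  have hk : 0 < Real.sqrt (norm0 a) := Real.sqrt_pos.2 (Nat.cast_pos.2 (norm0_pos hne))
  exact (eq_div_iff hk.ne').2
    (le_antisymm (mul_sqrt_norm0_le_one ha hne fun r => haval.trans_le (hs r)) hge)

theorem stmt_6 {n : ℕ} (a : Fin n → ℝ)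
    (hsort : ∀ i j : Fin n, i ≤ j → a j ≤ a i) (hnn : ∀ i, 0 ≤ a i) (hne : a ≠ 0)
    (τ : ℝ) (hτ : 0 < τ) (hτne : τ ≠ 1 / Real.sqrt (norm0 a)) :
    ∃! sbar : Fin n → ℝ, ∀ s, srObj a τ sbar ≤ srObj a τ s := by
  obtain ⟨t, ht⟩ := exists_srObj_minimizer hnn hτ.le
  refine ⟨t, ht, fun s hs => ?_⟩
  by_contra hst
  exact hτne (eq_one_div_sqrt_norm0_of_srObj_minimizers_ne hnn hne hτ hs ht hst)
end

section
/- Let n₁ ≥ n₂, ρ > 0, and let A ∈ ℝ^{n₁×n₂} have singular value decomposition A = HΣWᵀ, where H ∈ ℝ^{n₁×n₁} and W ∈ ℝ^{n₂×n₂} are orthogonal and Σ ∈ ℝ^{n₁×n₂} has top n₂×n₂ block Diag(a) with a₁ ≥ ⋯ ≥ a_{n₂} ≥ 0 and zero remaining rows. Let 1 ≤ k ≤ n₂ and let s* ∈ ℝ^k be an optimal solution of the problem (Q_{w,c,ρ}) with w = (a₁,…,a_k) and c = √(a_{k+1}² + ⋯ + a_{n₂}²). Then (U*, V*), where U* = H·[Diag(√s*);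 0_{(n₁−k)×k}] and V* = W·[Diag(√s*); 0_{(n₂−k)×k}] with √s* = (√s*₁,…,√s*_k), is an optimal solution of the problem (BM_{A,ρ,k}). -/
open Matrix

/-- The Frobenius norm of a real matrix. -/
noncomputable def frob {m n : ℕ} (A : Matrix (Fin m) (Fin n) ℝ) : ℝ :=
  Real.sqrt (∑ i, ∑ j, (A i j) ^ 2)

/-- The Burer–Monteiro penalized objective
`f_pen(U,V) = ‖UVᵀ − A‖_F + (ρ/2)(‖U‖_F² + ‖V‖_F²)`. -/
noncomputable def fpen {n₁ n₂ k : ℕ} (A : Matrix (Fin n₁) (Fin n₂) ℝ) (ρ : ℝ)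
    (U : Matrix (Fin n₁) (Fin k) ℝ) (V : Matrix (Fin n₂) (Fin k) ℝ) : ℝ :=
  frob (U * Vᵀ - A) + ρ / 2 * (frob U ^ 2 + frob V ^ 2)

/-- The objective of problem (Q_{w,c,ρ}):
`√(‖s − w‖₂² + c²) + ρ ∑ᵢ sᵢ`. -/
noncomputable def qObj {k : ℕ} (ρ c : ℝ) (w s : Fin k → ℝ) : ℝ :=
  Real.sqrt ((∑ i, (s i - w i) ^ 2) + c ^ 2) + ρ * ∑ i, s i

/-- The rectangular "diagonal" matrix with diagonal entries `ξ` and zeros elsewhere. -/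
noncomputable def pad (m k : ℕ) (ξ : Fin k → ℝ) : Matrix (Fin m) (Fin k) ℝ :=
  Matrix.of fun i j => if (i : ℕ) = (j : ℕ) then ξ j else 0

/-- A discrete Young inequality: for antitone nonnegative `s` and `a`, the products `s i * a j`
are dominated by a separable function agreeing with them on the diagonal. -/
theorem exists_mul_le_add_of_antitone {s a : ℕ → ℝ} (hs : Antitone s) (ha : Antitone a)
    (hs0 : ∀ i, 0 ≤ s i) (ha0 : ∀ i, 0 ≤ a i) {n : ℕ} (hsn : s n = 0) :
    ∃ u v : ℕ → ℝ, (∀ i ≤ n, 0 ≤ u i) ∧ (∀ i ≤ n, 0 ≤ v i) ∧ (∀ i, u i + v i = s i * a i) ∧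
      ∀ i j, s i * a j ≤ u i + v j := by
  obtain ⟨u, hun, hu⟩ : ∃ u : ℕ → ℝ, u n = 0 ∧ ∀ i, u i - u (i + 1) = a i * (s i - s (i + 1)) :=
    ⟨fun i => ∑ l ∈ Finset.range n, a l * (s l - s (l + 1)) -
      ∑ l ∈ Finset.range i, a l * (s l - s (l + 1)), by simp,
      fun i => by simp only [Finset.sum_range_succ]; ring⟩
  have hs1 (i : ℕ) : s (i + 1) ≤ s i := hs i.le_succ
  have ha1 (i : ℕ) : a (i + 1) ≤ a i := ha i.le_succ
  have hanti : Antitone u := antitone_nat_of_succ_le fun i => by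
    nlinarith [hu i, mul_nonneg (ha0 i) (sub_nonneg.2 (hs1 i))]
  have hvanti : Antitone fun i => s i * a i - u i := antitone_nat_of_succ_le fun i => by
    nlinarith [hu i, mul_nonneg (hs0 (i + 1)) (sub_nonneg.2 (ha1 i))]
  refine ⟨u, fun i => s i * a i - u i, fun i hi => hun ▸ hanti hi, fun i hi => ?_,
    fun i => by ring, fun i j => ?_⟩
  · have := hvanti hi
    simpa [hun, hsn] using this
  · rcases le_total i j with h | h
    · suffices a j * (s i - s j) ≤ u i - u j by linarith
      induction j, h using Nat.le_induction with
      | base => simp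
      | succ j h ih =>
        nlinarith [hu j, mul_le_mul_of_nonneg_right (ha1 j) (sub_nonneg.2 (hs (h.trans j.le_succ)))]
    · suffices u j - u i ≤ a j * (s j - s i) by linarith
      induction i, h using Nat.le_induction with
      | base => simp
      | succ i h ih =>
        nlinarith [hu i, mul_le_mul_of_nonneg_right (ha h) (sub_nonneg.2 (hs1 i))]

/-- Rearrangement inequality for doubly substochastic weights. -/
theorem sum_mul_le_of_substochastic {s a : ℕ → ℝ} (hs : Antitone s) (ha : Antitone a)
    (hs0 : ∀ i, 0 ≤ s i) (ha0 : ∀ i, 0 ≤ a i) {n : ℕ} (hsn : s n = 0)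
    (N : Fin n → Fin n → ℝ) (hN : ∀ i j, 0 ≤ N i j) (hrow : ∀ i, ∑ j, N i j ≤ 1)
    (hcol : ∀ j, ∑ i, N i j ≤ 1) :
    ∑ i : Fin n, ∑ j : Fin n, s i * a j * N i j ≤ ∑ i : Fin n, s i * a i := by
  obtain ⟨u, v, hu, hv, huv, hle⟩ := exists_mul_le_add_of_antitone hs ha hs0 ha0 hsn
  calc ∑ i : Fin n, ∑ j : Fin n, s i * a j * N i j
      ≤ ∑ i : Fin n, ∑ j : Fin n, (u i + v j) * N i j := by
        gcongr with i _ j _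
        · exact hN i j
        · exact hle i j
    _ = ∑ i : Fin n, u i * ∑ j, N i j + ∑ j : Fin n, v j * ∑ i, N i j := by
        simp only [add_mul, Finset.sum_add_distrib, Finset.mul_sum]
        congr 1
        exact Finset.sum_comm
    _ ≤ ∑ i : Fin n, u i + ∑ j : Fin n, v j := by
        gcongr with i _ j _
        · exact mul_le_of_le_one_right (hu i i.2.le) (hrow i)
        · exact mul_le_of_le_one_right (hv j j.2.le) (hcol j)
    _ = ∑ i : Fin n, s i * a i := by
        rw [← Finset.sum_add_distrib]
        exact Finset.sum_congr rfl fun i _ => huv i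

theorem frob_sq {m n : ℕ} (A : Matrix (Fin m) (Fin n) ℝ) :
    frob A ^ 2 = ∑ i, ∑ j, A i j ^ 2 :=
  Real.sq_sqrt (by positivity)

theorem frob_nonneg {m n : ℕ} (A : Matrix (Fin m) (Fin n) ℝ) : 0 ≤ frob A :=
  Real.sqrt_nonneg _

theorem frob_sq_eq_trace {m n : ℕ} (A : Matrix (Fin m) (Fin n) ℝ) :
    frob A ^ 2 = (Aᵀ * A).trace := by
  rw [frob_sq, Finset.sum_comm]
  simp [trace, mul_apply, sq]

theorem frob_transpose {m n : ℕ} (A : Matrix (Fin m) (Fin n) ℝ) : frob Aᵀ = frob A := by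
  unfold frob
  rw [Finset.sum_comm]
  rfl

theorem frob_orthogonal_mul {l m n : ℕ} {H : Matrix (Fin l) (Fin m) ℝ} (hH : Hᵀ * H = 1)
    (A : Matrix (Fin m) (Fin n) ℝ) : frob (H * A) = frob A := by
  rw [← sq_eq_sq₀ (frob_nonneg _) (frob_nonneg _), frob_sq_eq_trace, frob_sq_eq_trace,
    transpose_mul, Matrix.mul_assoc, ← Matrix.mul_assoc Hᵀ, hH, Matrix.one_mul]

theorem frob_mul_orthogonal_transpose {l m n : ℕ} {W : Matrix (Fin l) (Fin m) ℝ} (hW : Wᵀ * W = 1)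
    (A : Matrix (Fin n) (Fin m) ℝ) : frob (A * Wᵀ) = frob A := by
  rw [← frob_transpose, transpose_mul, transpose_transpose, frob_orthogonal_mul hW, frob_transpose]

/-- Bessel's inequality for a matrix whose columns are orthogonal of norm at most one. -/
theorem frob_transpose_mul_sq_le {l m n : ℕ} {P : Matrix (Fin l) (Fin m) ℝ} {d : Fin m → ℝ}
    (hP : Pᵀ * P = diagonal d) (hd : ∀ i, d i ≤ 1) (A : Matrix (Fin l) (Fin n) ℝ) :
    frob (Pᵀ * A) ^ 2 ≤ frob A ^ 2 := by
  have h1 : frob (A - P * (Pᵀ * A)) ^ 2 =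
      frob A ^ 2 - 2 * frob (Pᵀ * A) ^ 2 + frob (P * (Pᵀ * A)) ^ 2 := by
    simp only [frob_sq_eq_trace, transpose_sub, transpose_mul, transpose_transpose,
      Matrix.sub_mul, Matrix.mul_sub, trace_sub, Matrix.mul_assoc]
    ring
  have h2 : frob (P * (Pᵀ * A)) ^ 2 ≤ frob (Pᵀ * A) ^ 2 := by
    rw [frob_sq_eq_trace, transpose_mul, Matrix.mul_assoc, ← Matrix.mul_assoc Pᵀ P, hP,
      frob_sq, Finset.sum_comm]
    refine Finset.sum_le_sum fun j _ => ?_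
    rw [diag_apply, mul_apply]
    refine Finset.sum_le_sum fun i _ => ?_
    rw [transpose_apply, diagonal_mul]
    nlinarith [mul_nonneg (sub_nonneg.2 (hd i)) (sq_nonneg ((Pᵀ * A) i j))]
  nlinarith [sq_nonneg (frob (A - P * (Pᵀ * A)))]

/-- Singular value decomposition of a real matrix; the columns of `P` belonging to the zero
singular values vanish. -/
theorem exists_svd {m n : ℕ} (X : Matrix (Fin m) (Fin n) ℝ) :
    ∃ (σ : ℕ → ℝ) (P : Matrix (Fin m) (Fin n) ℝ) (Q : Matrix (Fin n) (Fin n) ℝ) (d : Fin n → ℝ),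
      Antitone σ ∧ (∀ i, 0 ≤ σ i) ∧ (∀ i, X.rank ≤ i → σ i = 0) ∧ Qᵀ * Q = 1 ∧
      Pᵀ * P = diagonal d ∧ (∀ i, d i ≤ 1) ∧ (∀ i, d i * σ i = σ i) ∧
      X = P * diagonal (fun i : Fin n => σ i) * Qᵀ := by
  set T := toEuclideanLin X with hT
  have hn : Module.finrank ℝ (EuclideanSpace ℝ (Fin n)) = n := by simp
  set b := T.isSymmetric_adjoint_comp_self.eigenvectorBasis hn
  set Q : Matrix (Fin n) (Fin n) ℝ := of fun i j => b j i with hQ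
  set σ := T.singularValues
  have hinner (i j : Fin n) : inner ℝ (T (b i)) (T (b j)) = if i = j then σ i ^ 2 else 0 := by
    rw [← LinearMap.adjoint_inner_right, ← LinearMap.comp_apply,
      LinearMap.IsSymmetric.apply_eigenvectorBasis, inner_smul_right,
      orthonormal_iff_ite.1 b.orthonormal, T.sq_singularValues_fin hn]
    split_ifs with h <;> simp [h]
  have hQQ : Qᵀ * Q = 1 := by
    ext i j
    have := orthonormal_iff_ite.1 b.orthonormal i j
    rw [one_apply, ← this, mul_apply, PiLp.inner_apply]
    exact Finset.sum_congr rfl fun r _ => mul_comm _ _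
  have hTb (r : Fin m) (i : Fin n) : T (b i) r = (X * Q) r i := rfl
  have hY : (X * Q)ᵀ * (X * Q) = diagonal fun i : Fin n => σ i ^ 2 := by
    ext i j
    rw [diagonal_apply, ← hinner, mul_apply, PiLp.inner_apply]
    refine Finset.sum_congr rfl fun r _ => ?_
    rw [hTb, hTb, transpose_apply]
    exact mul_comm _ _
  refine ⟨σ, X * Q * diagonal fun i : Fin n => (σ i)⁻¹, Q,
    fun i => (σ i)⁻¹ * σ i ^ 2 * (σ i)⁻¹, T.singularValues_antitone, T.singularValues_nonneg,
    fun i hi => ?_, hQQ, ?_, fun i => ?_, fun i => ?_, ?_⟩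
  · refine T.singularValues_eq_zero_iff_le_finrank_range.2 (le_of_eq_of_le ?_ hi)
    rw [X.rank_eq_finrank_range_toLin (EuclideanSpace.basisFun (Fin m) ℝ).toBasis
      (EuclideanSpace.basisFun (Fin n) ℝ).toBasis, hT, toEuclideanLin_eq_toLin_orthonormal]
  · rw [transpose_mul, diagonal_transpose, Matrix.mul_assoc, ← Matrix.mul_assoc (X * Q)ᵀ, hY,
      diagonal_mul_diagonal, diagonal_mul_diagonal]
    simp only [mul_assoc]
  · by_cases h : σ i = 0
    · simp [h]
    · field_simp; rfl
  · by_cases h : σ i = 0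
    · simp [h]
    · field_simp
  · have h : X * Q * (diagonal fun i : Fin n => (σ i)⁻¹) * (diagonal fun i : Fin n => σ i) =
        X * Q := by
      ext r i
      rw [mul_diagonal, mul_diagonal]
      by_cases h : σ i = 0
      · have h0 := congr_fun₂ hY i i
        rw [diagonal_apply_eq, h, mul_apply, zero_pow two_ne_zero] at h0
        simp only [transpose_apply] at h0
        rw [Finset.sum_eq_zero_iff_of_nonneg fun _ _ => mul_self_nonneg _] at h0
        simp [mul_self_eq_zero.1 (h0 r (Finset.mem_univ r))]
      · rw [mul_assoc, inv_mul_cancel₀ h, mul_one]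
    rw [h, Matrix.mul_assoc, mul_eq_one_comm.1 hQQ, Matrix.mul_one]

theorem sum_sq_row_le_one {l m : ℕ} {P : Matrix (Fin l) (Fin m) ℝ} {d : Fin m → ℝ}
    (hP : Pᵀ * P = diagonal d) (hd : ∀ i, d i ≤ 1) (r : Fin l) : ∑ i, P r i ^ 2 ≤ 1 := by
  have h := frob_transpose_mul_sq_le hP hd (of fun q (_ : Fin 1) => if q = r then (1 : ℝ) else 0)
  simpa [frob_sq, mul_apply] using h

theorem sum_sq_col_le_one {l m : ℕ} {P : Matrix (Fin l) (Fin m) ℝ} {d : Fin m → ℝ}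
    (hP : Pᵀ * P = diagonal d) (hd : ∀ i, d i ≤ 1) (i : Fin m) : ∑ r, P r i ^ 2 ≤ 1 := by
  have h := congr_fun₂ hP i i
  rw [mul_apply, diagonal_apply_eq] at h
  simp only [transpose_apply, ← sq] at h
  exact h.trans_le (hd i)

theorem sum_pad_mul {m k : ℕ} (h : k ≤ m) (ξ : Fin k → ℝ) (j : Fin k) (f : Fin m → ℝ) :
    ∑ r, pad m k ξ r j * f r = ξ j * f (Fin.castLE h j) := by
  rw [Finset.sum_eq_single (Fin.castLE h j)]
  · simp [pad]
  · intro r _ hr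
    have : (r : ℕ) ≠ j := fun e => hr (Fin.ext e)
    simp [pad, this]
  · simp

theorem frob_pad_sq {m k : ℕ} (h : k ≤ m) (ξ : Fin k → ℝ) : frob (pad m k ξ) ^ 2 = ∑ j, ξ j ^ 2 := by
  rw [frob_sq, Finset.sum_comm]
  refine Finset.sum_congr rfl fun j _ => ?_
  simp only [sq]
  rw [sum_pad_mul h]
  simp [pad]

/-- Von Neumann's trace inequality against a rectangular diagonal matrix. -/
theorem sum_mul_diag_le {m n : ℕ} (h : n ≤ m) {σ a : ℕ → ℝ} (hσ : Antitone σ) (ha : Antitone a)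
    (hσ0 : ∀ i, 0 ≤ σ i) (ha0 : ∀ i, 0 ≤ a i) (hσn : σ n = 0)
    {P : Matrix (Fin m) (Fin n) ℝ} {Q : Matrix (Fin n) (Fin n) ℝ} {d e : Fin n → ℝ}
    (hP : Pᵀ * P = diagonal d) (hd : ∀ i, d i ≤ 1) (hQ : Qᵀ * Q = diagonal e)
    (he : ∀ i, e i ≤ 1) :
    ∑ j : Fin n, a j * (P * diagonal (fun i : Fin n => σ i) * Qᵀ) (Fin.castLE h j) j ≤
      ∑ i : Fin n, σ i * a i := by
  refine le_trans ?_ (sum_mul_le_of_substochastic hσ ha hσ0 ha0 hσn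
    (fun i j => (P (Fin.castLE h j) i ^ 2 + Q j i ^ 2) / 2) (fun i j => by positivity)
    (fun i => ?_) (fun j => ?_))
  · rw [Finset.sum_comm]
    refine Finset.sum_le_sum fun j _ => ?_
    rw [mul_apply, Finset.mul_sum]
    refine Finset.sum_le_sum fun i _ => ?_
    rw [mul_diagonal, transpose_apply]
    nlinarith [mul_nonneg (mul_nonneg (hσ0 i) (ha0 j)) (sq_nonneg (P (Fin.castLE h j) i - Q j i))]
  · have h1 : ∑ j : Fin n, P (Fin.castLE h j) i ^ 2 ≤ ∑ r, P r i ^ 2 := by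
      refine (Finset.sum_map Finset.univ (Fin.castLEEmb h) fun r => P r i ^ 2).symm.trans_le ?_
      exact Finset.sum_le_univ_sum_of_nonneg fun r => sq_nonneg _
    rw [← Finset.sum_div, Finset.sum_add_distrib]
    linarith [sum_sq_col_le_one hP hd i, sum_sq_col_le_one hQ he i]
  · rw [← Finset.sum_div, Finset.sum_add_distrib]
    linarith [sum_sq_row_le_one hP hd (Fin.castLE h j), sum_sq_row_le_one hQ he j]

theorem trace_mul_transpose_le {m n : ℕ} (A B : Matrix (Fin m) (Fin n) ℝ) :
    (A * Bᵀ).trace ≤ (frob A ^ 2 + frob B ^ 2) / 2 := by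
  rw [frob_sq, frob_sq, ← Finset.sum_add_distrib, Finset.sum_div]
  refine Finset.sum_le_sum fun i _ => ?_
  rw [diag_apply, mul_apply, ← Finset.sum_add_distrib, Finset.sum_div]
  refine Finset.sum_le_sum fun j _ => ?_
  rw [transpose_apply]
  linarith [two_mul_le_add_sq (A i j) (B i j)]

/-- The singular values of `U * Vᵀ` are at least as close to `a` as `U * Vᵀ` is to the diagonal
matrix of `a`, and their sum is bounded by the Frobenius norms of the factors. -/
theorem exists_singularValues_le {m n k : ℕ} (h : n ≤ m) {a : ℕ → ℝ} (ha : Antitone a)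
    (ha0 : ∀ i, 0 ≤ a i) (hk : k ≤ n) (U : Matrix (Fin m) (Fin k) ℝ)
    (V : Matrix (Fin n) (Fin k) ℝ) :
    ∃ σ : ℕ → ℝ, (∀ i, 0 ≤ σ i) ∧ (∀ i, k ≤ i → σ i = 0) ∧
      ∑ i : Fin n, (σ i - a i) ^ 2 ≤ frob (U * Vᵀ - pad m n fun i => a i) ^ 2 ∧
      ∑ i : Fin n, σ i ≤ (frob U ^ 2 + frob V ^ 2) / 2 := by
  obtain ⟨σ, P, Q, d, hσ, hσ0, hrank, hQ, hP, hd, hdσ, hX⟩ := exists_svd (U * Vᵀ)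
  have hσk (i : ℕ) (hi : k ≤ i) : σ i = 0 :=
    hrank i (((rank_mul_le_left _ _).trans (rank_le_width U)).trans hi)
  have hQ' : Qᵀ * Q = diagonal fun _ => 1 := by rw [hQ, diagonal_one]
  have hmid : Pᵀ * (U * Vᵀ) * Q = diagonal fun i : Fin n => σ i := by
    rw [hX, ← Matrix.mul_assoc, ← Matrix.mul_assoc, Matrix.mul_assoc _ Qᵀ, hQ, Matrix.mul_one, hP,
      diagonal_mul_diagonal]
    simp only [hdσ]
  refine ⟨σ, hσ0, hσk, ?_, ?_⟩
  · have hfrob : frob (U * Vᵀ) ^ 2 = ∑ i : Fin n, σ i ^ 2 := by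
      rw [hX, frob_mul_orthogonal_transpose hQ, frob_sq_eq_trace, transpose_mul,
        diagonal_transpose, Matrix.mul_assoc, ← Matrix.mul_assoc Pᵀ, hP, diagonal_mul_diagonal,
        diagonal_mul_diagonal, trace_diagonal]
      simp only [hdσ, sq]
    have hexp : frob (U * Vᵀ - pad m n fun i => a i) ^ 2 = frob (U * Vᵀ) ^ 2 -
        2 * ∑ j : Fin n, a j * (U * Vᵀ) (Fin.castLE h j) j + ∑ j : Fin n, a j ^ 2 := by
      rw [← frob_pad_sq h fun i => a i]
      have hcross : ∑ j : Fin n, a j * (U * Vᵀ) (Fin.castLE h j) j =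
          ∑ r, ∑ j, pad m n (fun i => a i) r j * (U * Vᵀ) r j := by
        rw [Finset.sum_comm]
        exact Finset.sum_congr rfl fun j _ =>
          (sum_pad_mul h (fun i => a i) j fun r => (U * Vᵀ) r j).symm
      simp only [hcross, frob_sq, Finset.mul_sum, ← Finset.sum_sub_distrib,
        ← Finset.sum_add_distrib, Matrix.sub_apply]
      exact Finset.sum_congr rfl fun r _ => Finset.sum_congr rfl fun j _ => by ring
    have htr := sum_mul_diag_le h hσ ha hσ0 ha0 (hσk n hk) hP hd hQ' fun _ => le_rfl
    rw [← hX] at htr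
    have hsum : ∑ i : Fin n, (σ i - a i) ^ 2 = ∑ i : Fin n, σ i ^ 2 -
        2 * ∑ i : Fin n, σ i * a i + ∑ i : Fin n, a i ^ 2 := by
      rw [Finset.mul_sum, ← Finset.sum_sub_distrib, ← Finset.sum_add_distrib]
      exact Finset.sum_congr rfl fun i _ => by ring
    linarith
  · have htr : ∑ i : Fin n, σ i = ((Pᵀ * U) * (Qᵀ * V)ᵀ).trace := by
      rw [transpose_mul, transpose_transpose, ← Matrix.mul_assoc, Matrix.mul_assoc Pᵀ, hmid,
        trace_diagonal]
    linarith [trace_mul_transpose_le (Pᵀ * U) (Qᵀ * V), frob_transpose_mul_sq_le hP hd U,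
      frob_transpose_mul_sq_le hQ' (fun _ => le_rfl) V]

theorem frob_pad_mul_transpose_sub_sq {m n k : ℕ} (h : n ≤ m) (a : Fin n → ℝ)
    (s : Fin k → ℝ) (hs : ∀ i, 0 ≤ s i) :
    frob ((pad m k fun i => √(s i)) * (pad n k fun i => √(s i))ᵀ - pad m n a) ^ 2 =
      ∑ i : Fin n, ((if hi : (i : ℕ) < k then s ⟨i, hi⟩ else 0) - a i) ^ 2 := by
  have hmul : (pad m k fun i => √(s i)) * (pad n k fun i => √(s i))ᵀ =
      pad m n fun i => if hi : (i : ℕ) < k then s ⟨i, hi⟩ else 0 := by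
    ext r j
    simp only [mul_apply, transpose_apply, pad, of_apply]
    by_cases hj : (j : ℕ) < k
    · rw [Finset.sum_eq_single ⟨j, hj⟩]
      · by_cases hr : (r : ℕ) = j <;> simp [hr, hj, Real.mul_self_sqrt (hs _)]
      · intro i _ hi
        have : (j : ℕ) ≠ i := fun e => hi (Fin.ext e.symm)
        simp [this]
      · simp
    · rw [Finset.sum_eq_zero]
      · simp [hj]
      · intro i _
        have : (j : ℕ) ≠ i := by omega
        simp [this]
  have hsub (b : Fin n → ℝ) : pad m n b - pad m n a = pad m n fun i => b i - a i := by
    ext r j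
    by_cases hr : (r : ℕ) = j <;> simp [pad, hr]
  rw [hmul, hsub, frob_pad_sq h]

theorem fpen_orthogonal {n₁ n₂ k : ℕ} {H : Matrix (Fin n₁) (Fin n₁) ℝ}
    {W : Matrix (Fin n₂) (Fin n₂) ℝ} (hH : Hᵀ * H = 1) (hW : Wᵀ * W = 1)
    (A : Matrix (Fin n₁) (Fin n₂) ℝ) (ρ : ℝ) (U : Matrix (Fin n₁) (Fin k) ℝ)
    (V : Matrix (Fin n₂) (Fin k) ℝ) :
    fpen (H * A * Wᵀ) ρ (H * U) (W * V) = fpen A ρ U V := by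
  have : H * U * (W * V)ᵀ - H * A * Wᵀ = H * (U * Vᵀ - A) * Wᵀ := by
    rw [transpose_mul, Matrix.mul_sub, Matrix.sub_mul]
    simp only [Matrix.mul_assoc]
  rw [fpen, this, frob_mul_orthogonal_transpose hW, frob_orthogonal_mul hH,
    frob_orthogonal_mul hH, frob_orthogonal_mul hW, fpen]

theorem sum_sub_sq_split {n k : ℕ} (hk : k ≤ n) (s : ℕ → ℝ) (hs : ∀ i, k ≤ i → s i = 0)
    (a : Fin n → ℝ) :
    ∑ i : Fin n, (s i - a i) ^ 2 = ∑ i : Fin k, (s i - a (Fin.castLE hk i)) ^ 2 +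
      ∑ i : Fin n, if k ≤ (i : ℕ) then a i ^ 2 else 0 := by
  obtain ⟨m, rfl⟩ := Nat.exists_eq_add_of_le hk
  rw [Fin.sum_univ_add, Fin.sum_univ_add]
  have hlt (i : Fin k) : ¬ k ≤ (i : ℕ) := i.2.not_ge
  simp [hs, hlt]
  rfl

theorem sum_eq_of_eq_zero {n k : ℕ} (hk : k ≤ n) (s : ℕ → ℝ) (hs : ∀ i, k ≤ i → s i = 0) :
    ∑ i : Fin n, s i = ∑ i : Fin k, s i := by
  obtain ⟨m, rfl⟩ := Nat.exists_eq_add_of_le hk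
  simp [Fin.sum_univ_add, hs]

theorem stmt_15 {n₁ n₂ : ℕ} (hn : n₂ ≤ n₁) (ρ : ℝ) (hρ : 0 < ρ)
    (A : Matrix (Fin n₁) (Fin n₂) ℝ)
    (H : Matrix (Fin n₁) (Fin n₁) ℝ) (W : Matrix (Fin n₂) (Fin n₂) ℝ)
    (hH : Hᵀ * H = 1 ∧ H * Hᵀ = 1) (hW : Wᵀ * W = 1 ∧ W * Wᵀ = 1)
    (a : Fin n₂ → ℝ) (hsort : ∀ i j : Fin n₂, i ≤ j → a j ≤ a i) (hnn : ∀ i, 0 ≤ a i)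
    (hSVD : A = H * pad n₁ n₂ a * Wᵀ)
    (k : ℕ) (hk₁ : 1 ≤ k) (hk₂ : k ≤ n₂)
    (w : Fin k → ℝ) (hw : ∀ i : Fin k, w i = a ⟨i, lt_of_lt_of_le i.isLt hk₂⟩)
    (c : ℝ) (hc : c = Real.sqrt (∑ i : Fin n₂, if k ≤ (i : ℕ) then a i ^ 2 else 0))
    (sstar : Fin k → ℝ) (hfeas : ∀ i, 0 ≤ sstar i)
    (hsopt : ∀ s : Fin k → ℝ, (∀ i, 0 ≤ s i) → qObj ρ c w sstar ≤ qObj ρ c w s) :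
    ∀ (U : Matrix (Fin n₁) (Fin k) ℝ) (V : Matrix (Fin n₂) (Fin k) ℝ),
      fpen A ρ (H * pad n₁ k fun i => Real.sqrt (sstar i))
        (W * pad n₂ k fun i => Real.sqrt (sstar i)) ≤ fpen A ρ U V := by
  intro U V
  have hU : U = H * (Hᵀ * U) := by rw [← Matrix.mul_assoc, hH.2, Matrix.one_mul]
  have hV : V = W * (Wᵀ * V) := by rw [← Matrix.mul_assoc, hW.2, Matrix.one_mul]
  rw [hU, hV, hSVD, fpen_orthogonal hH.1 hW.1, fpen_orthogonal hH.1 hW.1]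
  generalize Hᵀ * U = U
  generalize Wᵀ * V = V
  obtain rfl : w = fun i => a (Fin.castLE hk₂ i) := funext hw
  have hc2 : c ^ 2 = ∑ i : Fin n₂, if k ≤ (i : ℕ) then a i ^ 2 else 0 := by
    rw [hc, Real.sq_sqrt]
    exact Finset.sum_nonneg fun i _ => by split_ifs <;> positivity
  let a' : ℕ → ℝ := fun i => if hi : i < n₂ then a ⟨i, hi⟩ else 0
  have ha'_eq : (fun i : Fin n₂ => a' i) = a := by
    funext i
    simp [a']
  have ha'0 (i : ℕ) : 0 ≤ a' i := by
    by_cases hi : i < n₂ <;> simp [a', hi, hnn]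
  have ha' : Antitone a' := fun i j hij => by
    by_cases hj : j < n₂
    · simpa [a', hj, hij.trans_lt hj] using hsort ⟨i, hij.trans_lt hj⟩ ⟨j, hj⟩ hij
    · simpa [a', hj] using ha'0 i
  obtain ⟨σ, hσ0, hσk, hdist, hsum⟩ := exists_singularValues_le hn ha' ha'0 hk₂ U V
  have hdist' : ∑ i : Fin n₂, (σ i - a i) ^ 2 ≤ frob (U * Vᵀ - pad n₁ n₂ a) ^ 2 := by
    simpa only [ha'_eq, congr_fun ha'_eq] using hdist
  rw [sum_sub_sq_split hk₂ σ hσk, ← hc2] at hdist'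
  rw [sum_eq_of_eq_zero hk₂ σ hσk] at hsum
  have hstar : fpen (pad n₁ n₂ a) ρ (pad n₁ k fun i => √(sstar i))
      (pad n₂ k fun i => √(sstar i)) = qObj ρ c (fun i => a (Fin.castLE hk₂ i)) sstar := by
    have h := frob_pad_mul_transpose_sub_sq hn a sstar hfeas
    rw [sum_sub_sq_split hk₂ (fun i => if hi : i < k then sstar ⟨i, hi⟩ else 0)
      (fun i hi => by simp [hi]), ← hc2] at h
    rw [fpen, qObj, frob_pad_sq (hk₂.trans hn), frob_pad_sq hk₂,
      ← Real.sqrt_sq (frob_nonneg (_ - _)), h]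
    simp only [Real.sq_sqrt (hfeas _), Fin.is_lt, dite_true, Fin.eta]
    ring
  rw [hstar]
  calc qObj ρ c (fun i => a (Fin.castLE hk₂ i)) sstar
      ≤ qObj ρ c (fun i => a (Fin.castLE hk₂ i)) fun i => σ i := hsopt _ fun i => hσ0 i
    _ ≤ frob (U * Vᵀ - pad n₁ n₂ a) + ρ * ((frob U ^ 2 + frob V ^ 2) / 2) := by
        unfold qObj
        gcongr
        exact Real.sqrt_le_iff.2 ⟨frob_nonneg _, hdist'⟩
    _ = fpen (pad n₁ n₂ a) ρ U V := by
        unfold fpen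
        ring
end
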